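/- For complex q, z with |q| < 1 and |z| < 1: (-zq;q)_inf / (z^2 q;q)_inf = sum_{p >= 0} z^p sum_{j = 0}^{floor(p/2)} q^{C(p-2j+1,2) + j} / ( (q;q)_{p-2j} (q;q)_j ). (The coefficient of z^p on the right is the generating function J_p(q) of jagged partitions of length p.) -/

import Mathlib

open scoped BigOperators

noncomputable section

/-- Finite q-Pochhammer symbol `(a;q)_n`. -/
def qP (q a : ℂ) (n : ℕ) : ℂ := ∏ m ∈ Finset.range n, (1 - a * q ^ m)

/-- Infinite q-Pochhammer symbol `(a;q)_∞`. -/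
def qPInf (q a : ℂ) : ℂ := ∏' m : ℕ, (1 - a * q ^ m)

theorem one_sub_pow_ne {q : ℂ} (hq : ‖q‖ < 1) (n : ℕ) : 1 - q * q ^ n ≠ 0 := by
  intro h
  have h1 : q ^ (n + 1) = 1 := by rw [pow_succ']; linear_combination -h
  have h2 : ‖q‖ ^ (n + 1) = 1 := by rw [← norm_pow, h1, norm_one]
  have h3 : ‖q‖ ^ (n + 1) < 1 := pow_lt_one₀ (norm_nonneg _) hq (by omega)
  linarith

theorem qP_tendsto (q a : ℂ) (hq : ‖q‖ < 1) :
    Filter.Tendsto (fun N => qP q a N) Filter.atTop (nhds (qPInf q a)) := by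
  have hs : Summable (fun m : ℕ => ‖-(a * q ^ m)‖) := by
    simp only [norm_neg, norm_mul, norm_pow]
    exact (summable_geometric_of_lt_one (norm_nonneg _) hq).mul_left _
  have := (multipliable_one_add_of_summable hs).tendsto_prod_tprod_nat
  simp only [← sub_eq_add_neg] at this
  exact this

theorem summable_of_rec {q : ℂ} (hq : ‖q‖ < 1) (c d : ℕ → ℂ) (hd : ∀ n, ‖d n‖ ≤ ‖q‖)
    (hc : ∀ n, c (n + 1) * (1 - q * q ^ n) = d n * c n) : Summable (fun n => ‖c n‖) := by
  obtain ⟨r, hr1, hr2⟩ := exists_between hq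
  have hr0 : 0 < r := lt_of_le_of_lt (norm_nonneg _) hr1
  have ht : Filter.Tendsto (fun n : ℕ => ‖1 - q * q ^ n‖ * r) Filter.atTop (nhds r) := by
    have := (((tendsto_pow_atTop_nhds_zero_of_norm_lt_one hq).const_mul q).const_sub 1).norm.mul_const r
    simpa using this
  apply summable_of_ratio_norm_eventually_le hr2
  filter_upwards [ht.eventually (lt_mem_nhds hr1)] with n hn
  simp only [norm_norm]
  have hpos : 0 < ‖1 - q * q ^ n‖ := norm_pos_iff.mpr (one_sub_pow_ne hq n)
  have h1 := congrArg norm (hc n)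
  rw [norm_mul, norm_mul] at h1
  have h2 : ‖d n‖ * ‖c n‖ ≤ (‖1 - q * q ^ n‖ * r) * ‖c n‖ :=
    mul_le_mul_of_nonneg_right ((hd n).trans hn.le) (norm_nonneg _)
  refine le_of_mul_le_mul_right ?_ hpos
  calc _ = ‖d n‖ * ‖c n‖ := h1
    _ ≤ _ := h2
    _ = _ := by ring

theorem summable_ps {c : ℕ → ℂ} (hc : Summable (fun n => ‖c n‖)) {x : ℂ} (hx : ‖x‖ ≤ 1) :
    Summable (fun n => ‖c n * x ^ n‖) := by
  refine Summable.of_nonneg_of_le (fun _ => norm_nonneg _) (fun n => ?_) hc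
  rw [norm_mul, norm_pow]
  exact mul_le_of_le_one_right (norm_nonneg _) (pow_le_one₀ (norm_nonneg _) hx)

theorem ps_tendsto {q : ℂ} (hq : ‖q‖ < 1) {c : ℕ → ℂ} (hc : Summable (fun n => ‖c n‖))
    (h0 : c 0 = 1) {x : ℂ} (hx : ‖x‖ ≤ 1) :
    Filter.Tendsto (fun N : ℕ => ∑' n, c n * (x * q ^ N) ^ n) Filter.atTop (nhds 1) := by
  have key : Filter.Tendsto (fun N : ℕ => ∑' n, c n * (x * q ^ N) ^ n) Filter.atTop
      (nhds (∑' n, c n * (0 : ℂ) ^ n)) := by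
    refine tendsto_tsum_of_dominated_convergence hc (fun n => ?_) (Filter.Eventually.of_forall ?_)
    · have := ((tendsto_pow_atTop_nhds_zero_of_norm_lt_one hq).const_mul x)
      rw [mul_zero] at this
      exact (this.pow n).const_mul _
    · intro N n
      rw [norm_mul, norm_pow]
      refine mul_le_of_le_one_right (norm_nonneg _) (pow_le_one₀ (norm_nonneg _) ?_)
      rw [norm_mul, norm_pow]
      exact mul_le_one₀ hx (by positivity) (pow_le_one₀ (norm_nonneg _) hq.le)
  have e : ∑' n, c n * (0 : ℂ) ^ n = 1 := by
    rw [tsum_eq_single 0]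
    · simp [h0]
    · intro n hn; simp [hn]
  rwa [e] at key

theorem ps_diff {q : ℂ} (hq : ‖q‖ < 1) {c : ℕ → ℂ} (hc : Summable (fun n => ‖c n‖))
    {x : ℂ} (hx : ‖x‖ ≤ 1) :
    ∑' n, c n * x ^ n - ∑' n, c n * (x * q) ^ n
      = ∑' n, (c (n + 1) * (1 - q * q ^ n)) * x ^ (n + 1) := by
  have hxq : ‖x * q‖ ≤ 1 := by
    rw [norm_mul]; exact mul_le_one₀ hx (norm_nonneg _) hq.le
  have s1 := (summable_ps hc hx).of_norm
  have s2 := (summable_ps hc hxq).of_norm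
  rw [← s1.tsum_sub s2, (s1.sub s2).tsum_eq_zero_add]
  simp only [pow_zero, sub_self, zero_add]
  refine tsum_congr fun n => ?_
  rw [mul_pow]; ring

def ca (q : ℂ) (n : ℕ) : ℂ := q ^ (Nat.choose (n + 1) 2) * (qP q q n)⁻¹
def cb (q : ℂ) (n : ℕ) : ℂ := q ^ n * (qP q q n)⁻¹

theorem qP_succ (q a : ℂ) (n : ℕ) : qP q a (n + 1) = qP q a n * (1 - a * q ^ n) :=
  Finset.prod_range_succ _ _

theorem qP_zero (q a : ℂ) : qP q a 0 = 1 := Finset.prod_range_zero _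

theorem ca_rec {q : ℂ} (hq : ‖q‖ < 1) (n : ℕ) :
    ca q (n + 1) * (1 - q * q ^ n) = q ^ (n + 1) * ca q n := by
  have h := one_sub_pow_ne hq n
  have e : Nat.choose (n + 1 + 1) 2 = (n + 1) + Nat.choose (n + 1) 2 := by
    rw [Nat.choose_succ_succ' (n + 1) 1, Nat.choose_one_right]
  rw [ca, ca, qP_succ, mul_inv, e, pow_add q (n + 1)]
  linear_combination (q ^ (n + 1) * q ^ (Nat.choose (n + 1) 2) * (qP q q n)⁻¹) * inv_mul_cancel₀ h

theorem cb_rec {q : ℂ} (hq : ‖q‖ < 1) (n : ℕ) :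
    cb q (n + 1) * (1 - q * q ^ n) = q * cb q n := by
  have h := one_sub_pow_ne hq n
  rw [cb, cb, qP_succ, mul_inv]
  linear_combination (q ^ (n + 1) * (qP q q n)⁻¹) * inv_mul_cancel₀ h

theorem ca_summable {q : ℂ} (hq : ‖q‖ < 1) : Summable (fun n => ‖ca q n‖) :=
  summable_of_rec hq _ (fun n => q ^ (n + 1)) (fun n => by
    rw [norm_pow]; exact pow_le_of_le_one (norm_nonneg _) hq.le (by omega)) (ca_rec hq)

theorem cb_summable {q : ℂ} (hq : ‖q‖ < 1) : Summable (fun n => ‖cb q n‖) :=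
  summable_of_rec hq _ (fun _ => q) (fun _ => le_rfl) (cb_rec hq)

theorem norm_xq {q x : ℂ} (hq : ‖q‖ < 1) (hx : ‖x‖ ≤ 1) (N : ℕ) : ‖x * q ^ N‖ ≤ 1 := by
  rw [norm_mul, norm_pow]
  exact mul_le_one₀ hx (by positivity) (pow_le_one₀ (norm_nonneg _) hq.le)

theorem euler_a {q x : ℂ} (hq : ‖q‖ < 1) (hx : ‖x‖ ≤ 1) :
    ∑' n, ca q n * x ^ n = qPInf q (-(x * q)) := by
  have step : ∀ y : ℂ, ‖y‖ ≤ 1 →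
      ∑' n, ca q n * y ^ n = (1 + y * q) * ∑' n, ca q n * (y * q) ^ n := by
    intro y hy
    have h := ps_diff hq (ca_summable hq) hy
    have e : ∑' n, (ca q (n + 1) * (1 - q * q ^ n)) * y ^ (n + 1)
        = (y * q) * ∑' n, ca q n * (y * q) ^ n := by
      rw [← tsum_mul_left]
      refine tsum_congr fun n => ?_
      rw [ca_rec hq, mul_pow]; ring
    rw [e] at h
    linear_combination h
  have iter : ∀ N : ℕ, ∑' n, ca q n * x ^ n
      = qP q (-(x * q)) N * ∑' n, ca q n * (x * q ^ N) ^ n := by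
    intro N
    induction N with
    | zero => simp [qP_zero]
    | succ N ih =>
      have e : x * q ^ (N + 1) = x * q ^ N * q := by ring
      rw [ih, step _ (norm_xq hq hx N), qP_succ, e]; ring
  have t := (qP_tendsto q (-(x * q)) hq).mul
    (ps_tendsto hq (ca_summable hq) (by simp [ca, qP_zero]) hx)
  simp only [← iter, mul_one] at t
  exact tendsto_nhds_unique tendsto_const_nhds t

theorem euler_b {q x : ℂ} (hq : ‖q‖ < 1) (hx : ‖x‖ ≤ 1) :
    qPInf q (x * q) * ∑' n, cb q n * x ^ n = 1 := by
  have step : ∀ y : ℂ, ‖y‖ ≤ 1 →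
      (1 - y * q) * ∑' n, cb q n * y ^ n = ∑' n, cb q n * (y * q) ^ n := by
    intro y hy
    have h := ps_diff hq (cb_summable hq) hy
    have e : ∑' n, (cb q (n + 1) * (1 - q * q ^ n)) * y ^ (n + 1)
        = (y * q) * ∑' n, cb q n * y ^ n := by
      rw [← tsum_mul_left]
      refine tsum_congr fun n => ?_
      rw [cb_rec hq]; ring
    rw [e] at h
    linear_combination h
  have iter : ∀ N : ℕ, qP q (x * q) N * ∑' n, cb q n * x ^ n
      = ∑' n, cb q n * (x * q ^ N) ^ n := by
    intro N
    induction N with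
    | zero => simp [qP_zero]
    | succ N ih =>
      have e : x * q ^ (N + 1) = x * q ^ N * q := by ring
      rw [e, ← step _ (norm_xq hq hx N), ← ih, qP_succ]; ring
  have t := (qP_tendsto q (x * q) hq).mul_const (∑' n, cb q n * x ^ n)
  simp only [iter] at t
  exact tendsto_nhds_unique t (ps_tendsto hq (cb_summable hq) (by simp [cb, qP_zero]) hx)

/-- Generating function of jagged partitions of fixed length. -/
theorem jagged_length_generating (q z : ℂ) (hq : ‖q‖ < 1)
    (hz : ‖z‖ < 1) :
    qPInf q (-(z * q)) / qPInf q (z ^ 2 * q)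
    = ∑' p : ℕ, z ^ p *
        ∑ j ∈ Finset.range (p / 2 + 1),
          q ^ (Nat.choose (p - 2 * j + 1) 2 + j) *
            ((qP q q (p - 2 * j))⁻¹ * (qP q q j)⁻¹) := by
  have hz2 : ‖z ^ 2‖ ≤ 1 := by rw [norm_pow]; exact pow_le_one₀ (norm_nonneg _) hz.le
  have hB := euler_b hq hz2
  have hne : qPInf q (z ^ 2 * q) ≠ 0 := left_ne_zero_of_mul_eq_one hB
  have hdiv : qPInf q (-(z * q)) / qPInf q (z ^ 2 * q)
      = (∑' n, cb q n * (z ^ 2) ^ n) * ∑' n, ca q n * z ^ n := by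
    rw [euler_a hq hz.le, div_eq_iff hne]
    linear_combination (-qPInf q (-(z * q))) * hB
  set g : ℕ → ℂ := fun k => if Even k then cb q (k / 2) * z ^ k else 0 with hg
  have hinj : Function.Injective (fun j : ℕ => 2 * j) := fun a b h => by
    simp only at h; omega
  have hcomp : ∀ j, g (2 * j) = cb q j * (z ^ 2) ^ j := by
    intro j
    simp [hg, pow_mul]
  have hout : ∀ k, k ∉ Set.range (fun j : ℕ => 2 * j) → g k = 0 := by
    intro k hk
    simp only [hg]
    rw [if_neg]
    rintro ⟨r, hr⟩
    exact hk ⟨r, by simp only; omega⟩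
  have hgs : Summable (fun k => ‖g k‖) := by
    refine (hinj.summable_iff (fun k hk => by simp only [hout k hk, norm_zero])).mp ?_
    have := summable_ps (cb_summable hq) hz2
    refine this.congr fun j => ?_
    simp only [Function.comp, hcomp]
  have hgt : ∑' n, cb q n * (z ^ 2) ^ n = ∑' k, g k := by
    rw [← hinj.tsum_eq (f := g)]
    · exact tsum_congr fun j => (hcomp j).symm
    · intro k hk
      by_contra h
      exact hk (hout k h)
  rw [hdiv, hgt, tsum_mul_tsum_eq_tsum_sum_range_of_summable_norm hgs
    (summable_ps (ca_summable hq) hz.le)]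
  refine tsum_congr fun p => ?_
  rw [Finset.mul_sum]
  symm
  refine Finset.sum_of_injOn (fun j => 2 * j) (hinj.injOn) ?_ ?_ ?_
  · intro j hj
    simp only [Finset.coe_range, Set.mem_Iio] at hj ⊢
    omega
  · intro k hk hk2
    rw [hout, zero_mul]
    rintro ⟨j, rfl⟩
    apply hk2
    refine ⟨j, ?_, rfl⟩
    simp only [Finset.coe_range, Set.mem_Iio, Finset.mem_range] at hk ⊢
    omega
  · intro j hj
    have hj' : 2 * j ≤ p := by
      simp only [Finset.mem_range] at hj
      omega
    rw [hcomp, ca, cb]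
    have e : z ^ p = (z ^ 2) ^ j * z ^ (p - 2 * j) := by
      rw [← pow_mul, ← pow_add]; congr 1; omega
    rw [e, pow_add]; ring
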